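/- Under Assumptions 1 and 2, let x* = argmin_{x ∈ X^T} C(x; θ) and let ρ = 1 − α/(4L), ζ = h²/α + h²/(2L). For any y ∈ X^T and any inexact parameter θ' ∈ Θ^T, the one-step inexact projected gradient update z = Π_{X^T}[y − (1/(2L)) ∇_x C(y; θ')] satisfies the contraction inequality ||z − x*||² ≤ ρ ||y − x*||² + (ζ/L) ||θ' − θ||². -/

import Mathlib

open Finset
open scoped RealInnerProductSpace

noncomputable section

/-- The total SOCO cost `C(x; θ) = ∑_{t=1}^T [f(x_t; θ_t) + d(x_t, x_{t-1})]`,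
where the initial point is `x 0`. -/
def socoCost {n p : ℕ} (T : ℕ)
    (f : EuclideanSpace ℝ (Fin n) → EuclideanSpace ℝ (Fin p) → ℝ)
    (d : EuclideanSpace ℝ (Fin n) → EuclideanSpace ℝ (Fin n) → ℝ)
    (θ : ℕ → EuclideanSpace ℝ (Fin p)) (x : ℕ → EuclideanSpace ℝ (Fin n)) : ℝ :=
  ∑ t ∈ Finset.Icc 1 T, (f (x t) (θ t) + d (x t) (x (t - 1)))

/-- The partial gradient of the total cost with respect to `x_t`:
`∇_{x_t} C(x;θ) = ∇_{x_t} f(x_t;θ_t) + ∇_{x_t} d(x_t,x_{t-1}) + ∇_{x_t} d(x_{t+1},x_t)·1_{t ≤ T-1}`,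
where `Gf` is the gradient of `f` in its first argument and `Gd1`, `Gd2` are the partial
gradients of `d` in its first and second arguments. -/
def socoGrad {n p : ℕ} (T : ℕ)
    (Gf : EuclideanSpace ℝ (Fin n) → EuclideanSpace ℝ (Fin p) → EuclideanSpace ℝ (Fin n))
    (Gd1 Gd2 : EuclideanSpace ℝ (Fin n) → EuclideanSpace ℝ (Fin n) → EuclideanSpace ℝ (Fin n))
    (θ : ℕ → EuclideanSpace ℝ (Fin p)) (x : ℕ → EuclideanSpace ℝ (Fin n)) (t : ℕ) :
    EuclideanSpace ℝ (Fin n) :=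
  Gf (x t) (θ t) + Gd1 (x t) (x (t - 1)) + (if t < T then Gd2 (x (t + 1)) (x t) else 0)

theorem sum_Icc_one_eq_sum_range (T : ℕ) (F : ℕ → ℝ) :
    ∑ t ∈ Finset.Icc 1 T, F t = ∑ i ∈ Finset.range T, F (i + 1) := by
  induction T with
  | zero => simp
  | succ k ih => rw [Finset.sum_Icc_succ_top (by omega), ih, Finset.sum_range_succ]

theorem sum_Icc_pred_eq_sum_ite {φ : ℕ → ℝ} (h0 : φ 0 = 0) (T : ℕ) :
    ∑ t ∈ Finset.Icc 1 T, φ (t - 1) = ∑ t ∈ Finset.Icc 1 T, if t < T then φ t else 0 := by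
  rw [sum_Icc_one_eq_sum_range, sum_Icc_one_eq_sum_range]
  cases T with
  | zero => simp
  | succ k =>
    rw [Finset.sum_range_succ', Finset.sum_range_succ]
    simp only [Nat.add_sub_cancel, h0, zero_add, lt_irrefl, if_false]
    congr 1
    refine Finset.sum_congr rfl fun i hi => ?_
    rw [if_pos (by simpa using hi)]

theorem sum_Icc_pred_le {φ : ℕ → ℝ} (h0 : φ 0 = 0) (hφ : ∀ t, 0 ≤ φ t) (T : ℕ) :
    ∑ t ∈ Finset.Icc 1 T, φ (t - 1) ≤ ∑ t ∈ Finset.Icc 1 T, φ t := by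
  rw [sum_Icc_pred_eq_sum_ite h0]
  refine Finset.sum_le_sum fun t _ => ?_
  split_ifs
  exacts [le_rfl, hφ t]

/-- Summation by parts: pairing the total gradient with a direction vanishing at time `0`. -/
theorem sum_inner_socoGrad {n p : ℕ} (T : ℕ)
    (Gf : EuclideanSpace ℝ (Fin n) → EuclideanSpace ℝ (Fin p) → EuclideanSpace ℝ (Fin n))
    (Gd1 Gd2 : EuclideanSpace ℝ (Fin n) → EuclideanSpace ℝ (Fin n) → EuclideanSpace ℝ (Fin n))
    (θ : ℕ → EuclideanSpace ℝ (Fin p)) (x v : ℕ → EuclideanSpace ℝ (Fin n)) (hv : v 0 = 0) :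
    ∑ t ∈ Finset.Icc 1 T, ⟪socoGrad T Gf Gd1 Gd2 θ x t, v t⟫
      = ∑ t ∈ Finset.Icc 1 T, (⟪Gf (x t) (θ t), v t⟫ + ⟪Gd1 (x t) (x (t - 1)), v t⟫
          + ⟪Gd2 (x t) (x (t - 1)), v (t - 1)⟫) := by
  have key := sum_Icc_pred_eq_sum_ite (φ := fun t => ⟪Gd2 (x (t + 1)) (x t), v t⟫)
    (by simp [hv]) T
  have shift : ∑ t ∈ Finset.Icc 1 T, ⟪Gd2 (x t) (x (t - 1)), v (t - 1)⟫
      = ∑ t ∈ Finset.Icc 1 T, ⟪Gd2 (x (t - 1 + 1)) (x (t - 1)), v (t - 1)⟫ := by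
    refine Finset.sum_congr rfl fun t ht => ?_
    rw [Nat.sub_add_cancel (Finset.mem_Icc.1 ht).1]
  rw [Finset.sum_add_distrib, shift, key, ← Finset.sum_add_distrib]
  refine Finset.sum_congr rfl fun t _ => ?_
  simp only [socoGrad, inner_add_left]
  split_ifs <;> simp

/-- First-order strong convexity of the total cost. -/
theorem socoCost_add_inner_le {n p T : ℕ}
    {X : Set (EuclideanSpace ℝ (Fin n))} {Θ : Set (EuclideanSpace ℝ (Fin p))}
    {f : EuclideanSpace ℝ (Fin n) → EuclideanSpace ℝ (Fin p) → ℝ}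
    {d : EuclideanSpace ℝ (Fin n) → EuclideanSpace ℝ (Fin n) → ℝ}
    {Gf : EuclideanSpace ℝ (Fin n) → EuclideanSpace ℝ (Fin p) → EuclideanSpace ℝ (Fin n)}
    {Gd1 Gd2 : EuclideanSpace ℝ (Fin n) → EuclideanSpace ℝ (Fin n) → EuclideanSpace ℝ (Fin n)}
    {α : ℝ}
    (hfsc : ∀ θ ∈ Θ, ∀ x ∈ X, ∀ y ∈ X,
      f y θ ≥ f x θ + ⟪Gf x θ, y - x⟫ + α / 2 * ‖y - x‖ ^ 2)
    (hdcv : ∀ a ∈ X, ∀ b ∈ X, ∀ a' ∈ X, ∀ b' ∈ X,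
      d a' b' ≥ d a b + ⟪Gd1 a b, a' - a⟫ + ⟪Gd2 a b, b' - b⟫)
    {θ : ℕ → EuclideanSpace ℝ (Fin p)} (hθ : ∀ t ∈ Finset.Icc 1 T, θ t ∈ Θ)
    {a b : ℕ → EuclideanSpace ℝ (Fin n)} (ha : ∀ t ≤ T, a t ∈ X) (hb : ∀ t ≤ T, b t ∈ X)
    (hab : a 0 = b 0) :
    socoCost T f d θ a + ∑ t ∈ Finset.Icc 1 T, ⟪socoGrad T Gf Gd1 Gd2 θ a t, b t - a t⟫
      + α / 2 * ∑ t ∈ Finset.Icc 1 T, ‖b t - a t‖ ^ 2 ≤ socoCost T f d θ b := by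
  rw [sum_inner_socoGrad T Gf Gd1 Gd2 θ a (fun t => b t - a t) (by simp [hab]),
    Finset.mul_sum, socoCost, socoCost, ← Finset.sum_add_distrib, ← Finset.sum_add_distrib]
  refine Finset.sum_le_sum fun t ht => ?_
  have h1 : t ≤ T := (Finset.mem_Icc.1 ht).2
  have h2 : t - 1 ≤ T := (Nat.sub_le t 1).trans h1
  linarith [hfsc _ (hθ t ht) _ (ha t h1) _ (hb t h1),
    hdcv _ (ha t h1) _ (ha _ h2) _ (hb t h1) _ (hb _ h2)]

theorem inner_add_inner_le_of_sq_add_sq_le {E : Type*} [NormedAddCommGroup E]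
    [InnerProductSpace ℝ E] {l : ℝ} (hl : 0 ≤ l) {g₁ g₂ u₁ u₂ : E}
    (h : ‖g₁‖ ^ 2 + ‖g₂‖ ^ 2 ≤ l ^ 2 * (‖u₁‖ ^ 2 + ‖u₂‖ ^ 2)) :
    ⟪g₁, u₁⟫ + ⟪g₂, u₂⟫ ≤ l * (‖u₁‖ ^ 2 + ‖u₂‖ ^ 2) := by
  have h1 := real_inner_le_norm g₁ u₁
  have h2 := real_inner_le_norm g₂ u₂
  have h3 : ‖g₁‖ * ‖u₁‖ + ‖g₂‖ * ‖u₂‖ ≤ l * (‖u₁‖ ^ 2 + ‖u₂‖ ^ 2) := by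
    refine (abs_le_of_sq_le_sq' ?_ (by positivity)).2
    have h4 := mul_le_mul_of_nonneg_right h (by positivity : 0 ≤ ‖u₁‖ ^ 2 + ‖u₂‖ ^ 2)
    nlinarith [sq_nonneg (‖g₁‖ * ‖u₂‖ - ‖g₂‖ * ‖u₁‖)]
  linarith

/-- The total gradient of an `l_f`-smooth and `l_d`-smooth cost satisfies the one-sided
Lipschitz bound with constant `l_f + 2 l_d`. -/
theorem sum_inner_socoGrad_sub_le {n p T : ℕ}
    {X : Set (EuclideanSpace ℝ (Fin n))} {Θ : Set (EuclideanSpace ℝ (Fin p))}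
    {Gf : EuclideanSpace ℝ (Fin n) → EuclideanSpace ℝ (Fin p) → EuclideanSpace ℝ (Fin n)}
    {Gd1 Gd2 : EuclideanSpace ℝ (Fin n) → EuclideanSpace ℝ (Fin n) → EuclideanSpace ℝ (Fin n)}
    {lf ld : ℝ} (hld : 0 ≤ ld)
    (hfsm : ∀ θ ∈ Θ, ∀ x ∈ X, ∀ y ∈ X, ‖Gf x θ - Gf y θ‖ ≤ lf * ‖x - y‖)
    (hdsm : ∀ a ∈ X, ∀ b ∈ X, ∀ a' ∈ X, ∀ b' ∈ X,
      ‖Gd1 a b - Gd1 a' b'‖ ^ 2 + ‖Gd2 a b - Gd2 a' b'‖ ^ 2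
        ≤ ld ^ 2 * (‖a - a'‖ ^ 2 + ‖b - b'‖ ^ 2))
    {θ : ℕ → EuclideanSpace ℝ (Fin p)} (hθ : ∀ t ∈ Finset.Icc 1 T, θ t ∈ Θ)
    {a b : ℕ → EuclideanSpace ℝ (Fin n)} (ha : ∀ t ≤ T, a t ∈ X) (hb : ∀ t ≤ T, b t ∈ X)
    (hab : a 0 = b 0) :
    ∑ t ∈ Finset.Icc 1 T, ⟪socoGrad T Gf Gd1 Gd2 θ a t, a t - b t⟫
      - ∑ t ∈ Finset.Icc 1 T, ⟪socoGrad T Gf Gd1 Gd2 θ b t, a t - b t⟫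
      ≤ (lf + 2 * ld) * ∑ t ∈ Finset.Icc 1 T, ‖a t - b t‖ ^ 2 := by
  have hv : a 0 - b 0 = 0 := by simp [hab]
  rw [sum_inner_socoGrad T Gf Gd1 Gd2 θ a (fun t => a t - b t) hv,
    sum_inner_socoGrad T Gf Gd1 Gd2 θ b (fun t => a t - b t) hv, ← Finset.sum_sub_distrib]
  have hshift := sum_Icc_pred_le (φ := fun t => ‖a t - b t‖ ^ 2) (by simp [hab])
    (fun t => by positivity) T
  calc _ ≤ ∑ t ∈ Finset.Icc 1 T,
        ((lf + ld) * ‖a t - b t‖ ^ 2 + ld * ‖a (t - 1) - b (t - 1)‖ ^ 2) := by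
        refine Finset.sum_le_sum fun t ht => ?_
        have h1 : t ≤ T := (Finset.mem_Icc.1 ht).2
        have h2 : t - 1 ≤ T := (Nat.sub_le t 1).trans h1
        have hf := hfsm _ (hθ t ht) _ (ha t h1) _ (hb t h1)
        have hf' := real_inner_le_norm (Gf (a t) (θ t) - Gf (b t) (θ t)) (a t - b t)
        have hd := inner_add_inner_le_of_sq_add_sq_le hld
          (hdsm _ (ha t h1) _ (ha _ h2) _ (hb t h1) _ (hb _ h2))
        have hm := mul_le_mul_of_nonneg_right hf (norm_nonneg (a t - b t))
        rw [inner_sub_left] at hf'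
        rw [inner_sub_left (Gd1 _ _), inner_sub_left (Gd2 _ _)] at hd
        linarith
    _ = (lf + ld) * ∑ t ∈ Finset.Icc 1 T, ‖a t - b t‖ ^ 2
        + ld * ∑ t ∈ Finset.Icc 1 T, ‖a (t - 1) - b (t - 1)‖ ^ 2 := by
        rw [Finset.sum_add_distrib, Finset.mul_sum, Finset.mul_sum]
    _ ≤ _ := by linarith [mul_le_mul_of_nonneg_left hshift hld]

theorem nonneg_of_forall_mul_add_sq_mul_nonneg {A B : ℝ}
    (h : ∀ r : ℝ, 0 < r → r ≤ 1 → 0 ≤ r * A + r ^ 2 * B) : 0 ≤ A := by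
  by_contra! hA
  have hB : 0 < -A + |B| := by linarith [abs_nonneg B]
  have hr : 0 < -A / (2 * (-A + |B|)) := div_pos (by linarith) (by linarith)
  have hr1 : -A / (2 * (-A + |B|)) ≤ 1 := by
    rw [div_le_one (by linarith)]
    linarith [abs_nonneg B]
  have h1 := h _ hr hr1
  have h2 : -A / (2 * (-A + |B|)) * (-A + |B|) = -A / 2 := by
    field_simp
  set r := -A / (2 * (-A + |B|))
  have h3 : 0 ≤ A + r * B := by
    refine nonneg_of_mul_nonneg_right (a := r) ?_ hr
    linarith
  have h4 : r * B ≤ r * |B| := mul_le_mul_of_nonneg_left (le_abs_self B) hr.le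
  nlinarith

/-- Variational inequality for the nearest point `z` to `u` among sequences `w` in a convex
set with prescribed value at time `0`. -/
theorem sum_inner_nonneg_of_forall_sum_norm_sq_le {E : Type*} [NormedAddCommGroup E]
    [InnerProductSpace ℝ E] {X : Set E} (hX : Convex ℝ X) {T : ℕ} {x₀ : E} {z u w : ℕ → E}
    (hz0 : z 0 = x₀) (hzX : ∀ t ∈ Finset.Icc 1 T, z t ∈ X)
    (hz : ∀ w : ℕ → E, w 0 = x₀ → (∀ t ∈ Finset.Icc 1 T, w t ∈ X) →
      ∑ t ∈ Finset.Icc 1 T, ‖z t - u t‖ ^ 2 ≤ ∑ t ∈ Finset.Icc 1 T, ‖w t - u t‖ ^ 2)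
    (hw0 : w 0 = x₀) (hwX : ∀ t ∈ Finset.Icc 1 T, w t ∈ X) :
    0 ≤ ∑ t ∈ Finset.Icc 1 T, ⟪z t - u t, w t - z t⟫ := by
  suffices h : 0 ≤ 2 * ∑ t ∈ Finset.Icc 1 T, ⟪z t - u t, w t - z t⟫ by linarith
  refine nonneg_of_forall_mul_add_sq_mul_nonneg
    (B := ∑ t ∈ Finset.Icc 1 T, ‖w t - z t‖ ^ 2) fun r hr hr1 => ?_
  have h := hz (fun t => z t + r • (w t - z t)) (by simp [hz0, hw0])
    fun t ht => hX.add_smul_sub_mem (hzX t ht) (hwX t ht) ⟨hr.le, hr1⟩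
  have hexp : ∑ t ∈ Finset.Icc 1 T, ‖z t + r • (w t - z t) - u t‖ ^ 2
      = ∑ t ∈ Finset.Icc 1 T, ‖z t - u t‖ ^ 2
        + (r * (2 * ∑ t ∈ Finset.Icc 1 T, ⟪z t - u t, w t - z t⟫)
        + r ^ 2 * ∑ t ∈ Finset.Icc 1 T, ‖w t - z t‖ ^ 2) := by
    simp only [Finset.mul_sum, ← Finset.sum_add_distrib]
    refine Finset.sum_congr rfl fun t _ => ?_
    rw [show z t + r • (w t - z t) - u t = (z t - u t) + r • (w t - z t) by abel,
      norm_add_sq_real, inner_smul_right, norm_smul, mul_pow, Real.norm_eq_abs, sq_abs]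
    ring
  linarith

/-- Quadratic growth of the total cost at its minimizer. -/
theorem socoCost_add_le_of_minimizer {n p T : ℕ}
    {X : Set (EuclideanSpace ℝ (Fin n))} (hX : Convex ℝ X) {Θ : Set (EuclideanSpace ℝ (Fin p))}
    {f : EuclideanSpace ℝ (Fin n) → EuclideanSpace ℝ (Fin p) → ℝ}
    {d : EuclideanSpace ℝ (Fin n) → EuclideanSpace ℝ (Fin n) → ℝ}
    {Gf : EuclideanSpace ℝ (Fin n) → EuclideanSpace ℝ (Fin p) → EuclideanSpace ℝ (Fin n)}
    {Gd1 Gd2 : EuclideanSpace ℝ (Fin n) → EuclideanSpace ℝ (Fin n) → EuclideanSpace ℝ (Fin n)}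
    {α : ℝ}
    (hfsc : ∀ θ ∈ Θ, ∀ x ∈ X, ∀ y ∈ X,
      f y θ ≥ f x θ + ⟪Gf x θ, y - x⟫ + α / 2 * ‖y - x‖ ^ 2)
    (hdcv : ∀ a ∈ X, ∀ b ∈ X, ∀ a' ∈ X, ∀ b' ∈ X,
      d a' b' ≥ d a b + ⟪Gd1 a b, a' - a⟫ + ⟪Gd2 a b, b' - b⟫)
    {θ : ℕ → EuclideanSpace ℝ (Fin p)} (hθ : ∀ t ∈ Finset.Icc 1 T, θ t ∈ Θ)
    {a b : ℕ → EuclideanSpace ℝ (Fin n)} (ha : ∀ t ≤ T, a t ∈ X) (hb : ∀ t ≤ T, b t ∈ X)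
    (hab : a 0 = b 0)
    (hmin : ∀ w : ℕ → EuclideanSpace ℝ (Fin n),
      w 0 = a 0 → (∀ t ∈ Finset.Icc 1 T, w t ∈ X) →
      socoCost T f d θ a ≤ socoCost T f d θ w) :
    socoCost T f d θ a + α / 4 * ∑ t ∈ Finset.Icc 1 T, ‖b t - a t‖ ^ 2
      ≤ socoCost T f d θ b := by
  set m : ℕ → EuclideanSpace ℝ (Fin n) := fun t => a t + (1 / 2 : ℝ) • (b t - a t) with hm
  have hmX : ∀ t ≤ T, m t ∈ X := fun t ht =>
    hX.add_smul_sub_mem (ha t ht) (hb t ht) ⟨by norm_num, by norm_num⟩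
  have hm0 : m 0 = a 0 := by simp [hm, hab]
  have hma : ∀ t, a t - m t = -((1 / 2 : ℝ) • (b t - a t)) := fun t => by simp [hm]
  have hmb : ∀ t, b t - m t = (1 / 2 : ℝ) • (b t - a t) := fun t => by
    simp only [hm]; module
  have h1 := socoCost_add_inner_le hfsc hdcv hθ hmX ha hm0
  have h2 := socoCost_add_inner_le hfsc hdcv hθ hmX hb (hm0.trans hab)
  have h3 := hmin m hm0 fun t ht => hmX t (Finset.mem_Icc.1 ht).2
  simp only [hma, inner_neg_right, Finset.sum_neg_distrib, norm_neg, norm_smul, mul_pow,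
    ← Finset.mul_sum] at h1
  simp only [hmb, norm_smul, mul_pow, ← Finset.mul_sum] at h2
  norm_num at h1 h2
  linarith

/-- Under Assumptions 1 and 2, let `x*` be the minimizer of `C(·;θ)` over
`X^T` and let `ρ = 1 − α/(4L)`, `ζ = h²/α + h²/(2L)` with `L = l_f + 2 l_d`. For any
`y ∈ X^T` and any inexact parameter `θ' ∈ Θ^T`, the one-step inexact projected gradient update
`z = Π_{X^T}[y − (1/(2L)) ∇_x C(y;θ')]` satisfies the contraction inequality
`‖z − x*‖² ≤ ρ ‖y − x*‖² + (ζ/L) ‖θ' − θ‖²`. -/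
theorem stmt6 {n p : ℕ} (T : ℕ) (hT : 1 ≤ T)
    (X : Set (EuclideanSpace ℝ (Fin n))) (Θ : Set (EuclideanSpace ℝ (Fin p)))
    (hXne : X.Nonempty) (hXcl : IsClosed X) (hXcv : Convex ℝ X)
    (x₀ : EuclideanSpace ℝ (Fin n)) (hx₀ : x₀ ∈ X)
    (f : EuclideanSpace ℝ (Fin n) → EuclideanSpace ℝ (Fin p) → ℝ)
    (d : EuclideanSpace ℝ (Fin n) → EuclideanSpace ℝ (Fin n) → ℝ)
    (Gf : EuclideanSpace ℝ (Fin n) → EuclideanSpace ℝ (Fin p) → EuclideanSpace ℝ (Fin n))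
    (Gd1 Gd2 : EuclideanSpace ℝ (Fin n) → EuclideanSpace ℝ (Fin n) → EuclideanSpace ℝ (Fin n))
    (α lf ld h : ℝ) (hα : 0 < α) (hlf : 0 ≤ lf) (hld : 0 ≤ ld)
    -- Assumption 1: `f(·;θ)` is `α`-strongly convex on `X` for every `θ ∈ Θ`
    (hfsc : ∀ θ ∈ Θ, ∀ x ∈ X, ∀ y ∈ X,
      f y θ ≥ f x θ + ⟪Gf x θ, y - x⟫ + α / 2 * ‖y - x‖ ^ 2)
    -- Assumption 1: `f(·;θ)` is `l_f`-smooth on `X` for every `θ ∈ Θ`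
    (hfsm : ∀ θ ∈ Θ, ∀ x ∈ X, ∀ y ∈ X, ‖Gf x θ - Gf y θ‖ ≤ lf * ‖x - y‖)
    -- Assumption 1: `d` is jointly convex on `X × X`
    (hdcv : ∀ a ∈ X, ∀ b ∈ X, ∀ a' ∈ X, ∀ b' ∈ X,
      d a' b' ≥ d a b + ⟪Gd1 a b, a' - a⟫ + ⟪Gd2 a b, b' - b⟫)
    -- Assumption 1: `d` is `l_d`-smooth on `X × X` (Euclidean norm on the product)
    (hdsm : ∀ a ∈ X, ∀ b ∈ X, ∀ a' ∈ X, ∀ b' ∈ X,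
      ‖Gd1 a b - Gd1 a' b'‖ ^ 2 + ‖Gd2 a b - Gd2 a' b'‖ ^ 2
        ≤ ld ^ 2 * (‖a - a'‖ ^ 2 + ‖b - b'‖ ^ 2))
    -- Assumption 2: `∇_x f(x;·)` is `h`-Lipschitz in the parameter
    (hlip : ∀ x ∈ X, ∀ θ ∈ Θ, ∀ θ' ∈ Θ, ‖Gf x θ - Gf x θ'‖ ≤ h * ‖θ - θ'‖)
    (L ρ ζ : ℝ) (hLdef : L = lf + 2 * ld) (hαL : α ≤ L)
    (hρdef : ρ = 1 - α / (4 * L)) (hζdef : ζ = h ^ 2 / α + h ^ 2 / (2 * L))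
    (θ θ' : ℕ → EuclideanSpace ℝ (Fin p))
    (hθ : ∀ t ∈ Finset.Icc 1 T, θ t ∈ Θ) (hθ' : ∀ t ∈ Finset.Icc 1 T, θ' t ∈ Θ)
    -- `x* = argmin_{x ∈ X^T} C(x;θ)`
    (xstar : ℕ → EuclideanSpace ℝ (Fin n))
    (hxstar0 : xstar 0 = x₀) (hxstarX : ∀ t ∈ Finset.Icc 1 T, xstar t ∈ X)
    (hxstaropt : ∀ w : ℕ → EuclideanSpace ℝ (Fin n),
      w 0 = x₀ → (∀ t ∈ Finset.Icc 1 T, w t ∈ X) →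
      socoCost T f d θ xstar ≤ socoCost T f d θ w)
    (y : ℕ → EuclideanSpace ℝ (Fin n))
    (hy0 : y 0 = x₀) (hyX : ∀ t ∈ Finset.Icc 1 T, y t ∈ X)
    -- `z = Π_{X^T}[y − (1/(2L)) ∇_x C(y;θ')]`, characterized as the point of `X^T` nearest
    -- (in the Euclidean product norm) to the inexact gradient step
    (z : ℕ → EuclideanSpace ℝ (Fin n))
    (hz0 : z 0 = x₀) (hzX : ∀ t ∈ Finset.Icc 1 T, z t ∈ X)
    (hzproj : ∀ w : ℕ → EuclideanSpace ℝ (Fin n),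
      w 0 = x₀ → (∀ t ∈ Finset.Icc 1 T, w t ∈ X) →
      ∑ t ∈ Finset.Icc 1 T,
          ‖z t - (y t - (1 / (2 * L)) • socoGrad T Gf Gd1 Gd2 θ' y t)‖ ^ 2
        ≤ ∑ t ∈ Finset.Icc 1 T,
          ‖w t - (y t - (1 / (2 * L)) • socoGrad T Gf Gd1 Gd2 θ' y t)‖ ^ 2) :
    ∑ t ∈ Finset.Icc 1 T, ‖z t - xstar t‖ ^ 2
      ≤ ρ * ∑ t ∈ Finset.Icc 1 T, ‖y t - xstar t‖ ^ 2
        + ζ / L * ∑ t ∈ Finset.Icc 1 T, ‖θ' t - θ t‖ ^ 2 := by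
  have hL : 0 < L := hα.trans_le hαL
  have extend : ∀ a : ℕ → EuclideanSpace ℝ (Fin n), a 0 = x₀ →
      (∀ t ∈ Finset.Icc 1 T, a t ∈ X) → ∀ t ≤ T, a t ∈ X := by
    intro a h0 ha t ht
    rcases Nat.eq_zero_or_pos t with rfl | hpos
    · rwa [h0]
    · exact ha t (Finset.mem_Icc.2 ⟨hpos, ht⟩)
  have hsX := extend xstar hxstar0 hxstarX
  have hyX' := extend y hy0 hyX
  have hzX' := extend z hz0 hzX
  have hgrow := socoCost_add_le_of_minimizer hXcv hfsc hdcv hθ hsX hzX'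
    (hxstar0.trans hz0.symm) (by rwa [hxstar0])
  have hconv := socoCost_add_inner_le hfsc hdcv hθ hyX' hsX (hy0.trans hxstar0.symm)
  have hdesc := socoCost_add_inner_le hfsc hdcv hθ hzX' hyX' (hz0.trans hy0.symm)
  have hsmooth := sum_inner_socoGrad_sub_le hld hfsm hdsm hθ hzX' hyX' (hz0.trans hy0.symm)
  have hproj := sum_inner_nonneg_of_forall_sum_norm_sq_le hXcv hz0 hzX hzproj hxstar0 hxstarX
  rw [← hLdef] at hsmooth
  -- the projection inequality in three-point form
  have hthree : ∑ t ∈ Finset.Icc 1 T, ⟪socoGrad T Gf Gd1 Gd2 θ' y t, z t - xstar t⟫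
      ≤ L * (∑ t ∈ Finset.Icc 1 T, ‖y t - xstar t‖ ^ 2 - ∑ t ∈ Finset.Icc 1 T, ‖z t - y t‖ ^ 2
        - ∑ t ∈ Finset.Icc 1 T, ‖z t - xstar t‖ ^ 2) := by
    have hmul := mul_nonneg (mul_pos two_pos hL).le hproj
    rw [← sub_nonneg]
    refine hmul.trans_eq ?_
    simp only [Finset.mul_sum, ← Finset.sum_sub_distrib]
    refine Finset.sum_congr rfl fun t _ => ?_
    have hy : ‖y t - xstar t‖ ^ 2 = ‖z t - y t‖ ^ 2 + 2 * ⟪z t - y t, xstar t - z t⟫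
        + ‖z t - xstar t‖ ^ 2 := by
      rw [norm_sub_rev (y t), norm_sub_rev (z t) (xstar t), ← norm_add_sq_real]
      congr 2
      abel
    rw [hy, show z t - (y t - (1 / (2 * L)) • socoGrad T Gf Gd1 Gd2 θ' y t)
      = (z t - y t) + (1 / (2 * L)) • socoGrad T Gf Gd1 Gd2 θ' y t by abel, inner_add_left,
      real_inner_smul_left, ← neg_sub (z t) (xstar t), inner_neg_right, inner_neg_right]
    field_simp
    ring
  -- the effect of the parameter error
  have herr : ∑ t ∈ Finset.Icc 1 T, ⟪socoGrad T Gf Gd1 Gd2 θ y t, z t - xstar t⟫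
      - ∑ t ∈ Finset.Icc 1 T, ⟪socoGrad T Gf Gd1 Gd2 θ' y t, z t - xstar t⟫
      ≤ α / 4 * ∑ t ∈ Finset.Icc 1 T, ‖z t - xstar t‖ ^ 2
        + h ^ 2 / α * ∑ t ∈ Finset.Icc 1 T, ‖θ' t - θ t‖ ^ 2 := by
    simp only [Finset.mul_sum, ← Finset.sum_sub_distrib, ← Finset.sum_add_distrib]
    refine Finset.sum_le_sum fun t ht => ?_
    have hdiff : socoGrad T Gf Gd1 Gd2 θ y t - socoGrad T Gf Gd1 Gd2 θ' y t
        = Gf (y t) (θ t) - Gf (y t) (θ' t) := by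
      simp only [socoGrad]; abel
    rw [← inner_sub_left, hdiff]
    have h1 := real_inner_le_norm (Gf (y t) (θ t) - Gf (y t) (θ' t)) (z t - xstar t)
    have h2 := mul_le_mul_of_nonneg_right (hlip _ (hyX t ht) _ (hθ t ht) _ (hθ' t ht))
      (norm_nonneg (z t - xstar t))
    rw [norm_sub_rev (θ t)] at h2
    have h3 : α / 4 * ‖z t - xstar t‖ ^ 2 + h ^ 2 / α * ‖θ' t - θ t‖ ^ 2
        - h * ‖θ' t - θ t‖ * ‖z t - xstar t‖
        = (α / 2 * ‖z t - xstar t‖ - h * ‖θ' t - θ t‖) ^ 2 / α := by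
      field_simp
      ring
    have h4 : 0 ≤ (α / 2 * ‖z t - xstar t‖ - h * ‖θ' t - θ t‖) ^ 2 / α := by positivity
    linarith
  have hsplit : ∑ t ∈ Finset.Icc 1 T, ⟪socoGrad T Gf Gd1 Gd2 θ y t, z t - xstar t⟫
      = ∑ t ∈ Finset.Icc 1 T, ⟪socoGrad T Gf Gd1 Gd2 θ y t, z t - y t⟫
        - ∑ t ∈ Finset.Icc 1 T, ⟪socoGrad T Gf Gd1 Gd2 θ y t, xstar t - y t⟫ := by
    rw [← Finset.sum_sub_distrib]
    refine Finset.sum_congr rfl fun t _ => ?_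
    rw [← inner_sub_right, sub_sub_sub_cancel_right]
  have hflip : ∑ t ∈ Finset.Icc 1 T, ⟪socoGrad T Gf Gd1 Gd2 θ z t, y t - z t⟫
      = -∑ t ∈ Finset.Icc 1 T, ⟪socoGrad T Gf Gd1 Gd2 θ z t, z t - y t⟫ := by
    rw [← Finset.sum_neg_distrib]
    refine Finset.sum_congr rfl fun t _ => ?_
    rw [← inner_neg_right, neg_sub]
  simp only [norm_sub_rev (xstar _) (y _)] at hconv
  rw [hflip] at hdesc
  have hD : 0 ≤ α / 2 * ∑ t ∈ Finset.Icc 1 T, ‖y t - z t‖ ^ 2 := by positivity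
  have hY : 0 ≤ ∑ t ∈ Finset.Icc 1 T, ‖y t - xstar t‖ ^ 2 := by positivity
  have hE : 0 ≤ ∑ t ∈ Finset.Icc 1 T, ‖θ' t - θ t‖ ^ 2 := by positivity
  set Z := ∑ t ∈ Finset.Icc 1 T, ‖z t - xstar t‖ ^ 2
  set Y := ∑ t ∈ Finset.Icc 1 T, ‖y t - xstar t‖ ^ 2
  set E := ∑ t ∈ Finset.Icc 1 T, ‖θ' t - θ t‖ ^ 2
  have hmain : L * Z ≤ (L - α / 2) * Y + h ^ 2 / α * E := by linarith
  have hαY : 0 ≤ α / 4 * Y := by positivity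
  have hhE : 0 ≤ h ^ 2 / (2 * L) * E := by positivity
  refine le_of_mul_le_mul_left ?_ hL
  calc L * Z ≤ (L - α / 4) * Y + (h ^ 2 / α + h ^ 2 / (2 * L)) * E := by linarith
    _ = L * (ρ * Y + ζ / L * E) := by
      rw [hρdef, hζdef]
      field_simp
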